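/- Let K ∈ ℕ, let α_1, …, α_K ∈ ℝ, let E ∈ ℕ, and let λ ∈ ℂ satisfy λ ≠ (α_k + 2πm)² for all 1 ≤ k ≤ K and m ∈ ℤ, and λ ≠ m²π² for all m ∈ ℤ. Then −1/λ + Σ_{k=1}^K Σ_{m∈ℤ} 1/((α_k + 2πm)² − λ) + E · Σ_{m=1}^∞ 1/(m²π² − λ) = (E − 2)/(2λ) + (s(λ)/2) · Σ_{k=1}^K 1/(c(λ) − cos α_k) − E · c(λ)/(2λ·s(λ)). -/

import Mathlib

lemma aux_summable (a b : ℂ) : Summable fun m : ℤ => ((a + m) * (b + m))⁻¹ := by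
  apply EisensteinSeries.summable_inv_of_isBigO_rpow_inv (a := 2) (by norm_cast)
  simpa [pow_two] using (EisensteinSeries.linear_inv_isBigO_right 1 b).mul
    (EisensteinSeries.linear_inv_isBigO_right 1 a)

lemma aux_cot_hasSum (x : ℂ) (hx : x ∈ Complex.integerComplement) :
    HasSum (fun n : ℕ => 1 / (x - (n + 1)) + 1 / (x + (n + 1)))
      (Real.pi * Complex.cot (Real.pi * x) - 1 / x) := by
  rw [cot_series_rep' hx]
  exact (summable_cotTerm hx).hasSum

lemma aux_pair (a b : ℂ) (ha : a ∈ Complex.integerComplement)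
    (hb : b ∈ Complex.integerComplement) (hab : b - a ≠ 0) :
    ∑' m : ℤ, ((a + m) * (b + m))⁻¹ =
      (Real.pi * Complex.cot (Real.pi * a) - Real.pi * Complex.cot (Real.pi * b)) / (b - a) := by
  have h1 := (aux_summable a b).hasSum.nat_add_neg
  have h2 := (hasSum_nat_add_iff' 1).mpr h1
  have h3 := ((aux_cot_hasSum a ha).sub (aux_cot_hasSum b hb)).div_const (b - a)
  have key : ∀ m : ℤ, ((a + m) * (b + m))⁻¹ = (1 / (a + m) - 1 / (b + m)) / (b - a) := by
    intro m
    have := Complex.integerComplement_add_ne_zero ha m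
    have := Complex.integerComplement_add_ne_zero hb m
    field_simp
    ring
  have h4 := h2.unique (h3.congr_fun ?_)
  · have ha0 := Complex.integerComplement.ne_zero ha
    have hb0 := Complex.integerComplement.ne_zero hb
    simp only [Finset.sum_range_one] at h4
    have k0 := key 0
    simp only [Int.cast_zero, add_zero, Nat.cast_zero, neg_zero] at h4 k0
    rw [k0] at h4
    linear_combination h4
  · intro n
    have k1 := key ((n + 1 : ℕ) : ℤ)
    have k2 := key (-((n + 1 : ℕ) : ℤ))
    simp only [k1, k2]
    push_cast
    ring

lemma aux_alpha (α w : ℂ) (hw : w ≠ 0) (h : ∀ m : ℤ, w ^ 2 ≠ (α + 2 * Real.pi * m) ^ 2) :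
    ∑' m : ℤ, 1 / ((α + 2 * Real.pi * m) ^ 2 - w ^ 2) =
      Complex.sin w / w / 2 * (1 / (Complex.cos w - Complex.cos α)) := by
  have hpi : (Real.pi : ℂ) ≠ 0 := by exact_mod_cast Real.pi_ne_zero
  have ha : (α - w) / (2 * Real.pi) ∈ Complex.integerComplement := by
    rintro ⟨n, hn⟩
    rw [eq_div_iff (by simp [hpi])] at hn
    apply h (-n)
    push_cast
    have : w = α + 2 * Real.pi * (-n) := by linear_combination hn
    rw [← this]
  have hb : (α + w) / (2 * Real.pi) ∈ Complex.integerComplement := by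
    rintro ⟨n, hn⟩
    rw [eq_div_iff (by simp [hpi])] at hn
    apply h (-n)
    push_cast
    have : -w = α + 2 * Real.pi * (-n) := by linear_combination hn
    rw [← this]
    ring
  have hab : (α + w) / (2 * Real.pi) - (α - w) / (2 * Real.pi) = w / Real.pi := by
    field_simp
    ring
  have hp := aux_pair _ _ ha hb (by rw [hab]; positivity)
  rw [hab] at hp
  have e : ∀ m : ℤ, 1 / ((α + 2 * Real.pi * m) ^ 2 - w ^ 2) = (1 / (2 * Real.pi) ^ 2) *
      (((α - w) / (2 * Real.pi) + m) * ((α + w) / (2 * Real.pi) + m))⁻¹ := by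
    intro m
    rw [one_div, one_div, ← mul_inv]
    congr 1
    field_simp
    ring
  simp_rw [e]
  rw [tsum_mul_left, hp]
  have sne : ∀ x : ℂ, x ∈ Complex.integerComplement → Complex.sin (Real.pi * x) ≠ 0 := by
    intro x hx h0
    rw [Complex.sin_eq_zero_iff] at h0
    obtain ⟨k, hk⟩ := h0
    exact hx ⟨k, mul_left_cancel₀ hpi (by rw [hk]; ring)⟩
  have s1 := sne _ ha
  have s2 := sne _ hb
  have c : Complex.cos w - Complex.cos α =
      2 * Complex.sin (Real.pi * ((α + w) / (2 * Real.pi))) *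
        Complex.sin (Real.pi * ((α - w) / (2 * Real.pi))) := by
    rw [Complex.cos_sub_cos]
    have e1 : Real.pi * ((α + w) / (2 * Real.pi)) = (w + α) / 2 := by field_simp; ring
    have e2 : Real.pi * ((α - w) / (2 * Real.pi)) = -((w - α) / 2) := by field_simp; ring
    rw [e1, e2, Complex.sin_neg]
    ring
  have d : Complex.sin w = Complex.sin (Real.pi * ((α + w) / (2 * Real.pi))
      - Real.pi * ((α - w) / (2 * Real.pi))) := by
    congr 1
    field_simp
    ring
  rw [c, d, Complex.sin_sub, Complex.cot, Complex.cot]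
  generalize Real.pi * ((α + w) / (2 * Real.pi)) = B at *
  generalize Real.pi * ((α - w) / (2 * Real.pi)) = A at *
  field_simp

lemma aux_nat (w : ℂ) (hw : w ≠ 0) (h : ∀ m : ℤ, w ^ 2 ≠ (m : ℂ) ^ 2 * (Real.pi : ℂ) ^ 2) :
    ∑' m : ℕ, 1 / (((m : ℂ) + 1) ^ 2 * (Real.pi : ℂ) ^ 2 - w ^ 2) =
      1 / (2 * w ^ 2) - Complex.cos w / (2 * w * Complex.sin w) := by
  have hpi : (Real.pi : ℂ) ≠ 0 := by exact_mod_cast Real.pi_ne_zero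
  have ha : w / Real.pi ∈ Complex.integerComplement := by
    rintro ⟨n, hn⟩
    rw [eq_div_iff hpi] at hn
    apply h n
    rw [← hn]; ring
  have h3 := ((aux_cot_hasSum _ ha).mul_left (-1 / (2 * w * Real.pi))).tsum_eq
  have e : ∀ m : ℕ, 1 / (((m : ℂ) + 1) ^ 2 * (Real.pi : ℂ) ^ 2 - w ^ 2) =
      -1 / (2 * w * Real.pi) * (1 / (w / Real.pi - (m + 1)) + 1 / (w / Real.pi + (m + 1))) := by
    intro m
    have n1 : w - Real.pi * (m + 1) ≠ 0 := by
      intro h0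
      apply h (m + 1)
      rw [sub_eq_zero.mp h0]; push_cast; ring
    have n2 : w + Real.pi * (m + 1) ≠ 0 := by
      intro h0
      apply h (m + 1)
      rw [eq_neg_of_add_eq_zero_left h0]; push_cast; ring
    have e1 : w / Real.pi - (m + 1) = (w - Real.pi * (m + 1)) / Real.pi := by field_simp
    have e2 : w / Real.pi + (m + 1) = (w + Real.pi * (m + 1)) / Real.pi := by field_simp
    have e3 : ((m : ℂ) + 1) ^ 2 * (Real.pi : ℂ) ^ 2 - w ^ 2 =
      -((w - Real.pi * (m + 1)) * (w + Real.pi * (m + 1))) := by ring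
    rw [e1, e2, e3]
    field_simp
    ring
  simp_rw [e]
  rw [h3, mul_div_cancel₀ _ hpi, Complex.cot]
  have sne : Complex.sin w ≠ 0 := by
    intro h0
    rw [Complex.sin_eq_zero_iff] at h0
    obtain ⟨k, hk⟩ := h0
    apply h k
    rw [hk]; ring
  field_simp
  ring


/-- `c(λ) = cos ω` where `ω` is a complex square root of `λ`
(independent of the choice of square root). -/
noncomputable def cf (z : ℂ) : ℂ := Complex.cos (z ^ ((1 : ℂ) / 2))

/-- `s(λ) = sin(ω)/ω` where `ω` is a complex square root of `λ`
(independent of the choice of square root), with `s(0) = 1`. -/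
noncomputable def sf (z : ℂ) : ℂ :=
  if z = 0 then 1 else Complex.sin (z ^ ((1 : ℂ) / 2)) / z ^ ((1 : ℂ) / 2)

theorem stmt_4 (K E : ℕ) (α : Fin K → ℝ) (lam : ℂ)
    (h1 : ∀ k : Fin K, ∀ m : ℤ, lam ≠ (((α k + 2 * Real.pi * m : ℝ) : ℂ)) ^ 2)
    (h2 : ∀ m : ℤ, lam ≠ (m : ℂ) ^ 2 * (Real.pi : ℂ) ^ 2) :
    -1 / lam
      + ∑ k : Fin K, ∑' m : ℤ, 1 / ((((α k + 2 * Real.pi * m : ℝ) : ℂ)) ^ 2 - lam)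
      + E * ∑' m : ℕ, 1 / (((m : ℂ) + 1) ^ 2 * (Real.pi : ℂ) ^ 2 - lam)
      = ((E : ℂ) - 2) / (2 * lam)
        + sf lam / 2 * ∑ k : Fin K, 1 / (cf lam - Complex.cos ((α k : ℂ)))
        - E * cf lam / (2 * lam * sf lam) := by
  have hl : lam ≠ 0 := by simpa using h2 0
  set w : ℂ := lam ^ ((1 : ℂ) / 2) with hwdef
  have hw2 : lam = w ^ 2 := by
    rw [hwdef, ← Complex.cpow_nat_mul]; simp
  have hw : w ≠ 0 := by
    intro h0
    rw [h0] at hw2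
    simp at hw2
    exact hl hw2
  have hc : cf lam = Complex.cos w := rfl
  have hs : sf lam = Complex.sin w / w := by simp only [sf, if_neg hl, hwdef]
  rw [hc, hs]
  clear_value w
  subst hw2
  have hn := aux_nat w hw h2
  have hk : ∀ k : Fin K, ∑' m : ℤ, 1 / ((((α k + 2 * Real.pi * m : ℝ) : ℂ)) ^ 2 - w ^ 2) =
      Complex.sin w / w / 2 * (1 / (Complex.cos w - Complex.cos (α k : ℂ))) := by
    intro k
    rw [← aux_alpha (α k) w hw]
    · push_cast; rfl
    · intro m
      have := h1 k m
      push_cast at this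
      exact this
  rw [hn, Finset.sum_congr rfl (fun k _ => hk k), ← Finset.mul_sum]
  have sne : Complex.sin w ≠ 0 := by
    intro h0
    rw [Complex.sin_eq_zero_iff] at h0
    obtain ⟨k, hk⟩ := h0
    apply h2 k
    rw [hk]; ring
  generalize ∑ k : Fin K, 1 / (Complex.cos w - Complex.cos (α k : ℂ)) = S
  field_simp
  ring
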